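/- Let B(x₀,R) ⊂ ℝⁿ be a fixed ball and let u ∈ W^{1,2}(B(x₀,R); ℝᴺ) be a weak solution of the constant-coefficient system D_α(A^{αβ}_{ij} D_β u^j) = 0 for i = 1,…,N, where the constants A^{αβ}_{ij} satisfy the ellipticity condition ν|ξ|² ≤ A^{αβ}_{ij} ξ^i_α ξ^j_β for some ν > 0 and all ξ ∈ ℝ^{nN}. Then there exists a constant c (depending only on n, N, ν and the coefficients) such that for every t ∈ (0,1], ∫_{B(x₀,tR)} |Du|² dx ≤ c t^n ∫_{B(x₀,R)} |Du|² dx. -/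

import Mathlib

open MeasureTheory Metric

noncomputable section

/-- The partial derivative `D_α u^i` of the `i`-th component of `u` in the `α`-th
coordinate direction. -/
def pD (n N : ℕ) (u : EuclideanSpace ℝ (Fin n) → EuclideanSpace ℝ (Fin N))
    (x : EuclideanSpace ℝ (Fin n)) (a : Fin n) (i : Fin N) : ℝ :=
  fderiv ℝ u x (EuclideanSpace.single a 1) i

/-- `|Du|² = ∑_{α,i} (D_α u^i)²`. -/
def gradSq (n N : ℕ) (u : EuclideanSpace ℝ (Fin n) → EuclideanSpace ℝ (Fin N))
    (x : EuclideanSpace ℝ (Fin n)) : ℝ :=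
  ∑ a, ∑ i, (pD n N u x a i) ^ 2

/-- directional derivative along a coordinate axis -/
def dD {n : ℕ} {F : Type*} [NormedAddCommGroup F] [NormedSpace ℝ F] (a : Fin n)
    (w : EuclideanSpace ℝ (Fin n) → F) : EuclideanSpace ℝ (Fin n) → F :=
  fun x => fderiv ℝ w x (EuclideanSpace.single a 1)

section basics
variable {n : ℕ} {F : Type*} [NormedAddCommGroup F] [NormedSpace ℝ F]

lemma dD_contDiff {w : EuclideanSpace ℝ (Fin n) → F} (hw : ContDiff ℝ (⊤ : ℕ∞) w) (a : Fin n) :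
    ContDiff ℝ (⊤ : ℕ∞) (dD a w) := by
  unfold dD
  exact (hw.fderiv_right (m := (⊤ : ℕ∞)) (by simp)).clm_apply contDiff_const

lemma dD_comm {w : EuclideanSpace ℝ (Fin n) → F} (hw : ContDiff ℝ (⊤ : ℕ∞) w) (a b : Fin n) :
    dD a (dD b w) = dD b (dD a w) := by
  funext x
  have hs : IsSymmSndFDerivAt ℝ w x := hw.contDiffAt.isSymmSndFDerivAt
    (by simp only [minSmoothness_of_isRCLikeNormedField]; exact WithTop.coe_le_coe.2 le_top)
  have hd : DifferentiableAt ℝ (fderiv ℝ w) x :=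
    ((hw.fderiv_right (m := (⊤ : ℕ∞)) (by simp)).differentiable (by simp)) x
  have key : ∀ c d : Fin n, dD c (dD d w) x
      = fderiv ℝ (fderiv ℝ w) x (EuclideanSpace.single c 1) (EuclideanSpace.single d 1) := by
    intro c d
    unfold dD
    rw [fderiv_clm_apply hd (differentiableAt_const _)]
    simp
  rw [key, key]
  exact hs _ _

lemma hasFDerivAt_of_smooth {w : EuclideanSpace ℝ (Fin n) → F} (hw : ContDiff ℝ (⊤ : ℕ∞) w)
    (x) : HasFDerivAt w (fderiv ℝ w x) x := (hw.differentiable (by simp) x).hasFDerivAt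

lemma hasLine {w : EuclideanSpace ℝ (Fin n) → F} (hw : ContDiff ℝ (⊤ : ℕ∞) w) (a : Fin n)
    (x) : HasLineDerivAt ℝ w (dD a w x) x (EuclideanSpace.single a 1) :=
  (hasFDerivAt_of_smooth hw x).hasLineDerivAt _

lemma hasLine_coord {N : ℕ} {w : EuclideanSpace ℝ (Fin n) → EuclideanSpace ℝ (Fin N)}
    (hw : ContDiff ℝ (⊤ : ℕ∞) w) (a : Fin n) (i : Fin N) (x) :
    HasLineDerivAt ℝ (fun y => w y i) (dD a w x i) x (EuclideanSpace.single a 1) := by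
  have h1 := (EuclideanSpace.proj (𝕜 := ℝ) i : EuclideanSpace ℝ (Fin N) →L[ℝ] ℝ).hasFDerivAt.comp x
    (hasFDerivAt_of_smooth hw x)
  exact h1.hasLineDerivAt (EuclideanSpace.single a 1)

lemma hasDeriv_line {w : EuclideanSpace ℝ (Fin n) → F} (hw : ContDiff ℝ (⊤ : ℕ∞) w) (a : Fin n)
    (x) (s : ℝ) : HasDerivAt (fun s : ℝ => w (x + s • EuclideanSpace.single a 1))
      (dD a w (x + s • EuclideanSpace.single a 1)) s := by
  have h1 := hasFDerivAt_of_smooth hw (x + s • EuclideanSpace.single a 1)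
  have h2 : HasDerivAt (fun s : ℝ => x + s • (EuclideanSpace.single a 1 : EuclideanSpace ℝ (Fin n)))
      (EuclideanSpace.single a 1) s := by
    simpa using ((hasDerivAt_id s).smul_const
      (EuclideanSpace.single a 1 : EuclideanSpace ℝ (Fin n))).const_add x
  exact h1.comp_hasDerivAt s h2

end basics

section sol
variable {n N : ℕ} (A : Fin n → Fin n → Fin N → Fin N → ℝ)

/-- smooth classical solutions on the centred ball of radius `s` -/
def Sol (w : EuclideanSpace ℝ (Fin n) → EuclideanSpace ℝ (Fin N)) (s : ℝ) : Prop :=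
  ContDiff ℝ (⊤ : ℕ∞) w ∧ ∀ x ∈ ball (0 : EuclideanSpace ℝ (Fin n)) s, ∀ i,
    ∑ a, ∑ b, ∑ j, A a b i j * dD a (dD b w) x j = 0

variable {A}
lemma Sol.mono {w : EuclideanSpace ℝ (Fin n) → EuclideanSpace ℝ (Fin N)} {s r : ℝ}
    (h : Sol A w s) (hr : r ≤ s) : Sol A w r :=
  ⟨h.1, fun x hx => h.2 x (ball_subset_ball hr hx)⟩

lemma Sol.dD {w : EuclideanSpace ℝ (Fin n) → EuclideanSpace ℝ (Fin N)} {s : ℝ}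
    (h : Sol A w s) (c : Fin n) : Sol A (dD c w) s := by
  refine ⟨dD_contDiff h.1 c, fun x hx i => ?_⟩
  have h1 : HasLineDerivAt ℝ (fun y => ∑ a, ∑ b, ∑ j, A a b i j * _root_.dD a (_root_.dD b w) y j)
      (∑ a, ∑ b, ∑ j, A a b i j * _root_.dD c (_root_.dD a (_root_.dD b w)) x j) x
      (EuclideanSpace.single c 1) := by
    unfold HasLineDerivAt
    refine HasDerivAt.fun_sum fun a _ => HasDerivAt.fun_sum fun b _ => HasDerivAt.fun_sum
      fun j _ => ?_
    exact HasDerivAt.const_mul _ (hasLine_coord (dD_contDiff (dD_contDiff h.1 b) a) c j x)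
  have h2 : HasLineDerivAt ℝ (fun _ : EuclideanSpace ℝ (Fin n) => (0:ℝ)) 0 x
      (EuclideanSpace.single c 1) := by
    unfold HasLineDerivAt
    exact hasDerivAt_const _ _
  have h3 : HasLineDerivAt ℝ (fun y => ∑ a, ∑ b, ∑ j, A a b i j * _root_.dD a (_root_.dD b w) y j)
      0 x (EuclideanSpace.single c 1) := by
    refine h2.congr_of_eventuallyEq ?_
    filter_upwards [isOpen_ball.mem_nhds hx] with y hy
    exact h.2 y hy i
  have h4 := HasLineDerivAt.unique h1 h3
  rw [← h4]
  refine Finset.sum_congr rfl fun a _ => Finset.sum_congr rfl fun b _ => Finset.sum_congr rfl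
    fun j _ => ?_
  rw [dD_comm h.1 b c, dD_comm (dD_contDiff h.1 b) a c]

end sol


lemma divergence_zero {n : ℕ} {f f' : EuclideanSpace ℝ (Fin n) → ℝ} {v : EuclideanSpace ℝ (Fin n)} {s : ℝ}
    (hf : Continuous f) (hf' : Continuous f')
    (h0 : ∀ x ∉ closedBall (0 : EuclideanSpace ℝ (Fin n)) s, f x = 0)
    (h0' : ∀ x ∉ closedBall (0 : EuclideanSpace ℝ (Fin n)) s, f' x = 0)
    (hd : ∀ x, HasLineDerivAt ℝ f (f' x) x v) : Integrable f' ∧ ∫ x, f' x = 0 := by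
  have i1 : Integrable f := hf.integrable_of_hasCompactSupport
    (HasCompactSupport.intro (isCompact_closedBall _ _) h0)
  have i2 : Integrable f' := hf'.integrable_of_hasCompactSupport
    (HasCompactSupport.intro (isCompact_closedBall _ _) h0')
  refine ⟨i2, ?_⟩
  have := integral_bilinear_hasLineDerivAt_right_eq_neg_left_of_integrable (μ := volume)
    (f := fun _ : EuclideanSpace ℝ (Fin n) => (1:ℝ)) (f' := fun _ => (0:ℝ)) (g := f) (g' := f')
    (v := v) (B := ContinuousLinearMap.mul ℝ ℝ) (by simp) (by simpa using i2) (by simpa using i1)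
    (fun x _ => by unfold HasLineDerivAt; exact hasDerivAt_const _ _) (fun x _ => hd x)
  simpa using this

lemma cacc_alg {n N : ℕ} (A : Fin n → Fin n → Fin N → Fin N → ℝ)
    (ν : ℝ) (hν : 0 < ν)
    (hell : ∀ ξ : Fin n → Fin N → ℝ,
      ν * (∑ a, ∑ i, (ξ a i) ^ 2) ≤ ∑ a, ∑ b, ∑ i, ∑ j, A a b i j * ξ a i * ξ b j) (L : ℝ) :
    ∃ C : ℝ, 0 ≤ C ∧ ∀ (p : Fin n → Fin N → ℝ) (q : Fin N → ℝ) (e : ℝ) (d : Fin n → ℝ),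
      (∀ a, |d a| ≤ L) →
      ν / 2 * (e ^ 2 * ∑ a, ∑ i, (p a i) ^ 2) ≤
        ∑ a, ∑ b, ∑ i, ∑ j, (2 * e * d a * (A a b i j * p b j * q i)
          + e ^ 2 * (A a b i j * p b j * p a i)) + C * ∑ i, (q i) ^ 2 := by
  set δ : ℝ := ν / (2 * (n * N + 1)) with hδ
  have hδ0 : 0 < δ := by positivity
  set K : ℝ := L ^ 2 * ∑ a, ∑ b, ∑ i, ∑ j, (A a b i j) ^ 2 with hK
  have hK0 : 0 ≤ K := by positivity
  refine ⟨n * n * N * (K / δ), by positivity, ?_⟩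
  intro p q e d hd
  have hA : ∀ a b i j, (A a b i j) ^ 2 ≤ ∑ a, ∑ b, ∑ i, ∑ j, (A a b i j) ^ 2 := by
    intro a b i j
    calc (A a b i j) ^ 2 ≤ ∑ j, (A a b i j) ^ 2 :=
          Finset.single_le_sum (f := fun j => (A a b i j) ^ 2) (fun _ _ => by positivity)
            (Finset.mem_univ j)
      _ ≤ ∑ i, ∑ j, (A a b i j) ^ 2 :=
          Finset.single_le_sum (f := fun i => ∑ j, (A a b i j) ^ 2) (fun _ _ => by positivity)
            (Finset.mem_univ i)
      _ ≤ ∑ b, ∑ i, ∑ j, (A a b i j) ^ 2 :=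
          Finset.single_le_sum (f := fun b => ∑ i, ∑ j, (A a b i j) ^ 2)
            (fun _ _ => by positivity) (Finset.mem_univ b)
      _ ≤ _ :=
          Finset.single_le_sum (f := fun a => ∑ b, ∑ i, ∑ j, (A a b i j) ^ 2)
            (fun _ _ => by positivity) (Finset.mem_univ a)
  have hterm : ∀ a b i j, e ^ 2 * (A a b i j * p a i * p b j) - δ * (e ^ 2 * (p b j) ^ 2)
      - K / δ * (q i) ^ 2 ≤ 2 * e * d a * (A a b i j * p b j * q i)
          + e ^ 2 * (A a b i j * p b j * p a i) := by
    intro a b i j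
    have h1 : (d a) ^ 2 * (A a b i j) ^ 2 ≤ K := by
      rw [hK]
      have : (d a) ^ 2 ≤ L ^ 2 := sq_le_sq' (by linarith [neg_abs_le (d a), hd a])
        ((le_abs_self _).trans (hd a))
      exact mul_le_mul this (hA a b i j) (by positivity) (by positivity)
    have h2 : (d a * A a b i j) ^ 2 / δ * (q i) ^ 2 ≤ K / δ * (q i) ^ 2 := by
      gcongr
      linarith [mul_pow (d a) (A a b i j) 2]
    have h3 : 0 ≤ δ * (e * p b j + (d a * A a b i j) / δ * q i) ^ 2 := by positivity
    have h4 : δ * (e * p b j + (d a * A a b i j) / δ * q i) ^ 2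
      = δ * (e ^ 2 * (p b j) ^ 2) + 2 * e * d a * (A a b i j * p b j * q i)
        + (d a * A a b i j) ^ 2 / δ * (q i) ^ 2 := by
      field_simp
      ring
    rw [h4] at h3
    linarith [show e ^ 2 * (A a b i j * p a i * p b j) = e ^ 2 * (A a b i j * p b j * p a i) by ring]
  have hsum := Finset.sum_le_sum fun a (_ : a ∈ Finset.univ) =>
    Finset.sum_le_sum fun b (_ : b ∈ Finset.univ) =>
    Finset.sum_le_sum fun i (_ : i ∈ Finset.univ) =>
    Finset.sum_le_sum fun j (_ : j ∈ Finset.univ) => hterm a b i j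
  refine le_trans ?_ (add_le_add_left hsum _)
  simp only [Finset.sum_sub_distrib, ← Finset.mul_sum, Finset.sum_const, Finset.card_univ,
    Fintype.card_fin, nsmul_eq_mul]
  have hE := mul_le_mul_of_nonneg_left (hell p) (sq_nonneg e)
  have hδν : δ * (n * N) ≤ ν / 2 := by
    rw [hδ, div_mul_eq_mul_div, div_le_div_iff₀ (by positivity) (by positivity)]
    nlinarith
  have hP : 0 ≤ e ^ 2 * ∑ a, ∑ i, (p a i) ^ 2 := by positivity
  have h5 := mul_le_mul_of_nonneg_right hδν hP
  nlinarith [h5, hE]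

lemma cacc {n N : ℕ} (A : Fin n → Fin n → Fin N → Fin N → ℝ)
    (ν : ℝ) (hν : 0 < ν)
    (hell : ∀ ξ : Fin n → Fin N → ℝ,
      ν * (∑ a, ∑ i, (ξ a i) ^ 2) ≤ ∑ a, ∑ b, ∑ i, ∑ j, A a b i j * ξ a i * ξ b j)
    (r s : ℝ) (hr : 0 < r) (hrs : r < s) :
    ∃ C : ℝ, 0 ≤ C ∧ ∀ w : EuclideanSpace ℝ (Fin n) → EuclideanSpace ℝ (Fin N), Sol A w s →
      ∀ c, ∫ x in ball (0 : EuclideanSpace ℝ (Fin n)) r, ‖dD c w x‖ ^ 2 ≤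
        C * ∫ x in ball (0 : EuclideanSpace ℝ (Fin n)) s, ‖w x‖ ^ 2 := by
  let η : ContDiffBump (0 : EuclideanSpace ℝ (Fin n)) := ⟨r, (r + s) / 2, hr, by linarith⟩
  have hη : ContDiff ℝ (⊤ : ℕ∞) η := η.contDiff
  have hηs : ∀ x ∉ closedBall (0 : EuclideanSpace ℝ (Fin n)) ((r + s) / 2), x ∉ tsupport η := by
    intro x hx
    rwa [η.tsupport_eq]
  have hη0 : ∀ x ∉ closedBall (0 : EuclideanSpace ℝ (Fin n)) ((r + s) / 2), η x = 0 :=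
    fun x hx => image_eq_zero_of_notMem_tsupport (hηs x hx)
  have hdη0 : ∀ a, ∀ x ∉ closedBall (0 : EuclideanSpace ℝ (Fin n)) ((r + s) / 2),
      dD a η x = 0 := by
    intro a x hx
    have : fderiv ℝ η x = 0 := by
      by_contra h
      exact hηs x hx (support_fderiv_subset ℝ h)
    simp [dD, this]
  have hL : ∃ L : ℝ, ∀ x, ∀ a, |dD a η x| ≤ L := by
    have : ∀ a, ∃ L : ℝ, 0 ≤ L ∧ ∀ x, |dD a η x| ≤ L := by
      intro a
      have hc : HasCompactSupport (dD a η) :=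
        HasCompactSupport.intro (isCompact_closedBall _ _) (hdη0 a)
      obtain ⟨L, hL⟩ := hc.exists_bound_of_continuous (dD_contDiff hη a).continuous
      exact ⟨L, (norm_nonneg _).trans (hL 0), hL⟩
    choose L hL0 hL using this
    refine ⟨∑ a, L a, fun x a => (hL a x).trans ?_⟩
    exact Finset.single_le_sum (fun a _ => hL0 a) (Finset.mem_univ a)
  obtain ⟨L, hL⟩ := hL
  obtain ⟨C, hC0, hC⟩ := cacc_alg A ν hν hell L
  refine ⟨C / (ν / 2), by positivity, fun w hw c => ?_⟩
  have hwc : Continuous w := hw.1.continuous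
  have hdc : ∀ b, Continuous (dD b w) := fun b => (dD_contDiff hw.1 b).continuous
  have hddc : ∀ a b, Continuous (dD a (dD b w)) :=
    fun a b => (dD_contDiff (dD_contDiff hw.1 b) a).continuous
  have hηc : Continuous η := η.continuous
  have hdηc : ∀ a, Continuous (dD a η) := fun a => (dD_contDiff hη a).continuous
  -- the vector field
  let f : Fin n → EuclideanSpace ℝ (Fin n) → ℝ := fun a x =>
    ∑ b, ∑ i, ∑ j, (η x * η x) * (A a b i j * (dD b w x j * w x i))
  let f' : Fin n → EuclideanSpace ℝ (Fin n) → ℝ := fun a x =>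
    ∑ b, ∑ i, ∑ j, ((dD a η x * η x + η x * dD a η x) * (A a b i j * (dD b w x j * w x i))
      + (η x * η x) * (A a b i j * (dD a (dD b w) x j * w x i + dD b w x j * dD a w x i)))
  have hline : ∀ a x, HasLineDerivAt ℝ (f a) (f' a x) x (EuclideanSpace.single a 1) := by
    intro a x
    unfold HasLineDerivAt
    refine HasDerivAt.fun_sum fun b _ => HasDerivAt.fun_sum fun i _ => HasDerivAt.fun_sum
      fun j _ => ?_
    have e1 := hasLine hη a x
    have e2 := hasLine_coord (dD_contDiff hw.1 b) a j x
    have e3 := hasLine_coord hw.1 a i x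
    unfold HasLineDerivAt at e1 e2 e3
    have := (e1.fun_mul e1).fun_mul ((e2.fun_mul e3).const_mul (A a b i j))
    simpa using this
  have hcoord : ∀ (g : EuclideanSpace ℝ (Fin n) → EuclideanSpace ℝ (Fin N)) (i : Fin N),
      Continuous g → Continuous (fun x => g x i) := by
    intro g i hg
    exact (EuclideanSpace.proj (𝕜 := ℝ) i).continuous.comp hg
  have hcf : ∀ a, Continuous (f a) := by
    intro a
    refine continuous_finsetSum _ fun b _ => continuous_finsetSum _ fun i _ =>
      continuous_finsetSum _ fun j _ => ?_
    exact (hηc.mul hηc).mul (continuous_const.mul ((hcoord _ j (hdc b)).mul (hcoord _ i hwc)))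
  have hcf' : ∀ a, Continuous (f' a) := by
    intro a
    refine continuous_finsetSum _ fun b _ => continuous_finsetSum _ fun i _ =>
      continuous_finsetSum _ fun j _ => ?_
    exact ((((hdηc a).mul hηc).add (hηc.mul (hdηc a))).mul
      (continuous_const.mul ((hcoord _ j (hdc b)).mul (hcoord _ i hwc)))).add
      ((hηc.mul hηc).mul (continuous_const.mul (((hcoord _ j (hddc a b)).mul (hcoord _ i hwc)).add
        ((hcoord _ j (hdc b)).mul (hcoord _ i (hdc a))))))
  have hz : ∀ a, ∀ x ∉ closedBall (0 : EuclideanSpace ℝ (Fin n)) ((r + s) / 2), f a x = 0 := by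
    intro a x hx
    simp [f, hη0 x hx]
  have hz' : ∀ a, ∀ x ∉ closedBall (0 : EuclideanSpace ℝ (Fin n)) ((r + s) / 2), f' a x = 0 := by
    intro a x hx
    simp [f', hη0 x hx, hdη0 a x hx]
  have hInt : ∀ a, Integrable (f' a) ∧ ∫ x, f' a x = 0 := fun a =>
    divergence_zero (hcf a) (hcf' a) (hz a) (hz' a) (hline a)
  have hI : ∫ x in ball (0 : EuclideanSpace ℝ (Fin n)) s, ∑ a, f' a x = 0 := by
    rw [setIntegral_eq_integral_of_forall_compl_eq_zero]
    · rw [integral_finsetSum _ fun a _ => (hInt a).1]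
      simp [(hInt _).2]
    · intro x hx
      refine Finset.sum_eq_zero fun a _ => hz' a x fun h => hx ?_
      exact closedBall_subset_ball (by linarith) h
  have hpt : ∀ x ∈ ball (0 : EuclideanSpace ℝ (Fin n)) s,
      ν / 2 * (η x ^ 2 * ‖dD c w x‖ ^ 2) ≤ ∑ a, f' a x + C * ‖w x‖ ^ 2 := by
    intro x hx
    have h1 := hC (fun b j => dD b w x j) (fun i => w x i) (η x) (fun a => dD a η x) (hL x)
    have h2 : ∑ a, f' a x = ∑ a, ∑ b, ∑ i, ∑ j,
        (2 * η x * dD a η x * (A a b i j * dD b w x j * w x i)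
          + η x ^ 2 * (A a b i j * dD b w x j * dD a w x i)) := by
      have h3 : ∑ a, ∑ b, ∑ i, ∑ j, η x ^ 2 * w x i * (A a b i j * dD a (dD b w) x j) = 0 := by
        have : ∀ i, ∑ a, ∑ b, ∑ j, η x ^ 2 * w x i * (A a b i j * dD a (dD b w) x j) = 0 := by
          intro i
          simp only [← Finset.mul_sum]
          rw [hw.2 x hx i, mul_zero]
        calc _ = ∑ a, ∑ i, ∑ b, ∑ j, η x ^ 2 * w x i * (A a b i j * dD a (dD b w) x j) :=
              Finset.sum_congr rfl fun a _ => Finset.sum_comm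
          _ = ∑ i, ∑ a, ∑ b, ∑ j, η x ^ 2 * w x i * (A a b i j * dD a (dD b w) x j) :=
              Finset.sum_comm
          _ = 0 := Finset.sum_eq_zero fun i _ => this i
      rw [← add_zero (∑ a, ∑ b, ∑ i, ∑ j, (2 * η x * dD a η x * (A a b i j * dD b w x j * w x i)
          + η x ^ 2 * (A a b i j * dD b w x j * dD a w x i))), ← h3]
      simp only [f', ← Finset.sum_add_distrib]
      refine Finset.sum_congr rfl fun a _ => Finset.sum_congr rfl fun b _ =>
        Finset.sum_congr rfl fun i _ => Finset.sum_congr rfl fun j _ => ?_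
      ring
    rw [h2]
    have h4 : ‖dD c w x‖ ^ 2 ≤ ∑ a, ∑ i, (dD a w x i) ^ 2 := by
      rw [EuclideanSpace.real_norm_sq_eq]
      exact Finset.single_le_sum (f := fun a => ∑ i, (dD a w x i) ^ 2)
        (fun _ _ => by positivity) (Finset.mem_univ c)
    have h5 : ‖w x‖ ^ 2 = ∑ i, (w x i) ^ 2 := EuclideanSpace.real_norm_sq_eq _
    rw [h5]
    refine le_trans ?_ h1
    gcongr
  have hbd : ∀ (g : EuclideanSpace ℝ (Fin n) → ℝ) (ρ : ℝ), Continuous g →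
      IntegrableOn g (ball (0 : EuclideanSpace ℝ (Fin n)) ρ) := by
    intro g ρ hg
    exact (hg.locallyIntegrable.integrableOn_isCompact (isCompact_closedBall 0 ρ)).mono_set
      ball_subset_closedBall
  have hcD : Continuous fun x => ‖dD c w x‖ ^ 2 := (hdc c).norm.pow 2
  have hcw : Continuous fun x => ‖w x‖ ^ 2 := hwc.norm.pow 2
  have hcs : Continuous fun x => ∑ a, f' a x := continuous_finsetSum _ fun a _ => hcf' a
  have k1 : ∫ x in ball (0 : EuclideanSpace ℝ (Fin n)) r, ‖dD c w x‖ ^ 2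
      ≤ ∫ x in ball (0 : EuclideanSpace ℝ (Fin n)) s, η x ^ 2 * ‖dD c w x‖ ^ 2 := by
    calc _ = ∫ x in ball (0 : EuclideanSpace ℝ (Fin n)) r, η x ^ 2 * ‖dD c w x‖ ^ 2 := by
          refine setIntegral_congr_fun measurableSet_ball fun x hx => ?_
          have : η x = 1 := η.one_of_mem_closedBall (ball_subset_closedBall hx)
          simp [this]
      _ ≤ _ := setIntegral_mono_set (hbd _ _ ((hηc.pow 2).mul hcD))
          (Filter.Eventually.of_forall fun x => by positivity)
          (ball_subset_ball hrs.le).eventuallyLE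
  have k2 : ∫ x in ball (0 : EuclideanSpace ℝ (Fin n)) s, ν / 2 * (η x ^ 2 * ‖dD c w x‖ ^ 2)
      ≤ ∫ x in ball (0 : EuclideanSpace ℝ (Fin n)) s, (∑ a, f' a x + C * ‖w x‖ ^ 2) :=
    setIntegral_mono_on (hbd _ _ (continuous_const.mul ((hηc.pow 2).mul hcD)))
      (hbd _ _ (hcs.add (continuous_const.mul hcw))) measurableSet_ball hpt
  rw [integral_add (hbd _ _ hcs) (hbd (fun x => C * ‖w x‖ ^ 2) _ (continuous_const.mul hcw)), hI, integral_const_mul,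
    integral_const_mul, zero_add] at k2
  rw [div_mul_eq_mul_div, le_div_iff₀ (by positivity)]
  nlinarith [mul_le_mul_of_nonneg_left k1 (by positivity : 0 ≤ ν / 2)]


lemma smooth_integrableOn_ball {n : ℕ} (g : EuclideanSpace ℝ (Fin n) → ℝ)
    (x : EuclideanSpace ℝ (Fin n)) (ρ : ℝ) (hg : Continuous g) :
    IntegrableOn g (ball x ρ) :=
  (hg.locallyIntegrable.integrableOn_isCompact (isCompact_closedBall x ρ)).mono_set
      ball_subset_closedBall

lemma cacc' {n N : ℕ} (A : Fin n → Fin n → Fin N → Fin N → ℝ)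
    (ν : ℝ) (hν : 0 < ν)
    (hell : ∀ ξ : Fin n → Fin N → ℝ,
      ν * (∑ a, ∑ i, (ξ a i) ^ 2) ≤ ∑ a, ∑ b, ∑ i, ∑ j, A a b i j * ξ a i * ξ b j)
    (r s : ℝ) (hr : 0 < r) (hrs : r < s) :
    ∃ C : ENNReal, C ≠ ⊤ ∧ ∀ w : EuclideanSpace ℝ (Fin n) → EuclideanSpace ℝ (Fin N), Sol A w s →
      ∀ c, ∫⁻ x in ball (0 : EuclideanSpace ℝ (Fin n)) r, ENNReal.ofReal (‖dD c w x‖ ^ 2) ≤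
        C * ∫⁻ x in ball (0 : EuclideanSpace ℝ (Fin n)) s, ENNReal.ofReal (‖w x‖ ^ 2) := by
  obtain ⟨C, hC0, hC⟩ := cacc A ν hν hell r s hr hrs
  refine ⟨ENNReal.ofReal C, ENNReal.ofReal_ne_top, fun w hw c => ?_⟩
  have h := hC w hw c
  have hcD : Continuous fun x => ‖dD c w x‖ ^ 2 := ((dD_contDiff hw.1 c).continuous).norm.pow 2
  have hcw : Continuous fun x => ‖w x‖ ^ 2 := hw.1.continuous.norm.pow 2
  rw [← ofReal_integral_eq_lintegral_ofReal (smooth_integrableOn_ball _ _ _ hcD)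
    (Filter.Eventually.of_forall fun x => by positivity),
    ← ofReal_integral_eq_lintegral_ofReal (smooth_integrableOn_ball _ _ _ hcw)
    (Filter.Eventually.of_forall fun x => by positivity), ← ENNReal.ofReal_mul hC0]
  exact ENNReal.ofReal_le_ofReal h

lemma oneD {F : Type*} [NormedAddCommGroup F] [NormedSpace ℝ F] [CompleteSpace F]
    (g g' : ℝ → F) (hg : ∀ s, HasDerivAt g (g' s) s) (hg' : Continuous g') (h : ℝ) (hh : 0 < h) :
    ‖g 0‖ ^ 2 ≤ 2 / h * (∫ s in (0:ℝ)..h, ‖g s‖ ^ 2) + 2 * h * ∫ s in (0:ℝ)..h, ‖g' s‖ ^ 2 := by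
  have hgc : Continuous g := continuous_iff_continuousAt.2 fun s => (hg s).continuousAt
  set M := ∫ s in (0:ℝ)..h, ‖g' s‖ with hM
  have hM0 : 0 ≤ M := intervalIntegral.integral_nonneg hh.le fun _ _ => norm_nonneg _
  have i1 : IntervalIntegrable (fun s => ‖g' s‖) volume 0 h := hg'.norm.intervalIntegrable _ _
  have i2 : IntervalIntegrable (fun s => ‖g' s‖ ^ 2) volume 0 h :=
    (hg'.norm.pow 2).intervalIntegrable _ _
  have i3 : IntervalIntegrable (fun s => ‖g s‖ ^ 2) volume 0 h :=
    (hgc.norm.pow 2).intervalIntegrable _ _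
  have cs : M ^ 2 ≤ h * ∫ s in (0:ℝ)..h, ‖g' s‖ ^ 2 := by
    have h0 : 0 ≤ ∫ s in (0:ℝ)..h, (‖g' s‖ - M / h) ^ 2 :=
      intervalIntegral.integral_nonneg hh.le fun _ _ => sq_nonneg _
    have h1 : ∫ s in (0:ℝ)..h, (‖g' s‖ - M / h) ^ 2
        = (∫ s in (0:ℝ)..h, ‖g' s‖ ^ 2) - 2 * (M / h) * M + h * (M / h) ^ 2 := by
      have : ∀ s, (‖g' s‖ - M / h) ^ 2 = ‖g' s‖ ^ 2 - 2 * (M / h) * ‖g' s‖ + (M / h) ^ 2 := by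
        intro s; ring
      simp only [this]
      rw [intervalIntegral.integral_add (i2.sub (i1.const_mul _)) (by simp),
        intervalIntegral.integral_sub i2 (i1.const_mul _), intervalIntegral.integral_const_mul]
      simp [hM]
    rw [h1] at h0
    have h2 : h * (M / h) ^ 2 = M ^ 2 / h := by field_simp
    have h3 : 2 * (M / h) * M = 2 * (M ^ 2 / h) := by ring
    rw [h2, h3] at h0
    have h4 : M ^ 2 / h ≤ ∫ s in (0:ℝ)..h, ‖g' s‖ ^ 2 := by linarith
    rw [div_le_iff₀ hh] at h4
    linarith
  have hpt : ∀ s ∈ Set.Icc 0 h, ‖g 0‖ ^ 2 ≤ 2 * ‖g s‖ ^ 2 + 2 * M ^ 2 := by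
    intro s hs
    have e1 : ∫ τ in (0:ℝ)..s, g' τ = g s - g 0 :=
      intervalIntegral.integral_eq_sub_of_hasDerivAt (fun x _ => hg x)
        (hg'.intervalIntegrable _ _)
    have e2 : ‖g s - g 0‖ ≤ M := by
      rw [← e1]
      refine (intervalIntegral.norm_integral_le_integral_norm hs.1).trans ?_
      exact intervalIntegral.integral_mono_interval le_rfl hs.1 hs.2
        (Filter.Eventually.of_forall fun _ => norm_nonneg _) i1
    have e3 : ‖g 0‖ ≤ ‖g s‖ + M := by
      have := norm_sub_norm_le (g 0) (g s)
      rw [norm_sub_rev] at this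
      linarith
    nlinarith [norm_nonneg (g 0), norm_nonneg (g s), sq_nonneg (‖g s‖ - M)]
  have hI : ∫ s in (0:ℝ)..h, ‖g 0‖ ^ 2 ≤ ∫ s in (0:ℝ)..h, (2 * ‖g s‖ ^ 2 + 2 * M ^ 2) :=
    intervalIntegral.integral_mono_on hh.le (by simp) ((i3.const_mul _).add (by simp)) hpt
  rw [intervalIntegral.integral_add (i3.const_mul _) (by simp),
    intervalIntegral.integral_const_mul] at hI
  simp only [intervalIntegral.integral_const, smul_eq_mul, sub_zero] at hI
  have hfin : h * ‖g 0‖ ^ 2 ≤ h * (2 / h * (∫ s in (0:ℝ)..h, ‖g s‖ ^ 2)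
      + 2 * h * ∫ s in (0:ℝ)..h, ‖g' s‖ ^ 2) := by
    have : h * (2 / h * (∫ s in (0:ℝ)..h, ‖g s‖ ^ 2) + 2 * h * ∫ s in (0:ℝ)..h, ‖g' s‖ ^ 2)
      = 2 * (∫ s in (0:ℝ)..h, ‖g s‖ ^ 2) + 2 * h * (h * ∫ s in (0:ℝ)..h, ‖g' s‖ ^ 2) := by
      field_simp
    rw [this]
    nlinarith
  exact le_of_mul_le_mul_left hfin hh

/-- slab inside a ball -/
def slab {n : ℕ} (J : Finset (Fin n)) (r t : ℝ) : Set (EuclideanSpace ℝ (Fin n)) :=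
  ball 0 r ∩ {x | ∀ i ∈ J, |x i| ≤ t}

lemma measurable_coord {n : ℕ} (i : Fin n) :
    Measurable (fun x : EuclideanSpace ℝ (Fin n) => x i) :=
  (EuclideanSpace.proj (𝕜 := ℝ) i).continuous.measurable

lemma slab_meas {n : ℕ} (J : Finset (Fin n)) (r t : ℝ) : MeasurableSet (slab J r t) := by
  refine measurableSet_ball.inter ?_
  have : {x : EuclideanSpace ℝ (Fin n) | ∀ i ∈ J, |x i| ≤ t}
      = ⋂ i ∈ J, {x : EuclideanSpace ℝ (Fin n) | |x i| ≤ t} := by ext; simp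
  rw [this]
  refine J.measurableSet_biInter fun i _ => ?_
  exact measurableSet_le (measurable_coord i).abs measurable_const

lemma slab_fubini {n : ℕ} (J : Finset (Fin n)) (a : Fin n) (ha : a ∉ J) (r t h : ℝ) 
    (G : EuclideanSpace ℝ (Fin n) → ENNReal) (hG : Measurable G) :
    ∫⁻ x in slab (insert a J) r t, ∫⁻ s in Set.Ioc 0 h, G (x + s • EuclideanSpace.single a 1)
      ≤ ENNReal.ofReal (2 * t) * ∫⁻ x in slab J (r + h) t, G x := by
  have hm : Measurable (fun p : EuclideanSpace ℝ (Fin n) × ℝ =>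
      G (p.1 + p.2 • EuclideanSpace.single a 1)) := by
    refine hG.comp ?_
    exact (continuous_fst.add (continuous_snd.smul continuous_const)).measurable
  rw [lintegral_lintegral_swap hm.aemeasurable]
  let K : ℝ → EuclideanSpace ℝ (Fin n) → ENNReal := fun s y =>
    (slab J (r + h) t).indicator G y * (if |y a - s| ≤ t then 1 else 0)
  have hKm : Measurable (fun p : ℝ × EuclideanSpace ℝ (Fin n) => K p.1 p.2) := by
    refine Measurable.mul ((hG.indicator (slab_meas _ _ _)).comp measurable_snd) ?_
    refine Measurable.ite ?_ measurable_const measurable_const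
    exact measurableSet_le (((measurable_coord a).comp measurable_snd).sub measurable_fst).abs
      measurable_const
  have hin : ∀ s ∈ Set.Ioc 0 h, ∫⁻ x in slab (insert a J) r t,
      G (x + s • EuclideanSpace.single a 1) ≤ ∫⁻ y, K s y := by
    intro s hs
    rw [← lintegral_indicator (slab_meas _ _ _),
      ← lintegral_sub_right_eq_self _ (s • (EuclideanSpace.single a 1 : EuclideanSpace ℝ (Fin n)))]
    refine lintegral_mono fun y => ?_
    by_cases hy : y - s • EuclideanSpace.single a 1 ∈ slab (insert a J) r t
    · rw [Set.indicator_of_mem hy]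
      obtain ⟨h1, h2⟩ := hy
      have e1 : y ∈ slab J (r + h) t := by
        refine ⟨?_, fun i hi => ?_⟩
        · rw [mem_ball_zero_iff] at h1 ⊢
          have : ‖s • (EuclideanSpace.single a 1 : EuclideanSpace ℝ (Fin n))‖ ≤ h := by
            rw [norm_smul, Real.norm_eq_abs, abs_of_pos hs.1]
            simpa using hs.2
          have h3 := norm_add_le (y - s • (EuclideanSpace.single a 1 : EuclideanSpace ℝ (Fin n)))
            (s • EuclideanSpace.single a 1)
          rw [sub_add_cancel] at h3
          linarith
        · have := h2 i (Finset.mem_insert_of_mem hi)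
          have hne : i ≠ a := fun h => ha (h ▸ hi)
          simpa [hne] using this
      have e2 : |y a - s| ≤ t := by
        have := h2 a (Finset.mem_insert_self _ _)
        simpa using this
      simp only [K, Set.indicator_of_mem e1, if_pos e2, sub_add_cancel, mul_one]
      exact le_rfl
    · rw [Set.indicator_of_notMem hy]
      exact bot_le
  calc _ ≤ ∫⁻ s in Set.Ioc 0 h, ∫⁻ y, K s y := setLIntegral_mono' measurableSet_Ioc hin
    _ ≤ ∫⁻ s, ∫⁻ y, K s y := setLIntegral_le_lintegral _ _
    _ = ∫⁻ y, ∫⁻ s, K s y := lintegral_lintegral_swap hKm.aemeasurable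
    _ = ∫⁻ y, (slab J (r + h) t).indicator G y * ENNReal.ofReal (2 * t) := by
        refine lintegral_congr fun y => ?_
        have hms : MeasurableSet {s : ℝ | |y a - s| ≤ t} :=
          measurableSet_le (measurable_const.sub measurable_id).abs measurable_const
        have hset : {s : ℝ | |y a - s| ≤ t} = Set.Icc (y a - t) (y a + t) := by
          ext s; simp only [Set.mem_ofPred_eq, Set.mem_Icc, abs_le]
          constructor <;> rintro ⟨h1, h2⟩ <;> constructor <;> linarith
        have hfun : (fun s : ℝ => (if |y a - s| ≤ t then (1 : ENNReal) else 0))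
            = {s : ℝ | |y a - s| ≤ t}.indicator 1 := by
          ext s; simp [Set.indicator]
        simp only [K]
        rw [lintegral_const_mul _ (by rw [hfun]; exact measurable_one.indicator hms), hfun,
          lintegral_indicator_one hms, hset, Real.volume_Icc]
        congr 2
        ring
    _ = _ := by
        rw [lintegral_mul_const _ (hG.indicator (slab_meas _ _ _)),
          lintegral_indicator (slab_meas _ _ _), mul_comm]

lemma slab_step {n N : ℕ} (J : Finset (Fin n)) (a : Fin n) (ha : a ∉ J) (r t h : ℝ) (hh : 0 < h)
    (w : EuclideanSpace ℝ (Fin n) → EuclideanSpace ℝ (Fin N)) (hw : ContDiff ℝ (⊤ : ℕ∞) w) :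
    ∫⁻ x in slab (insert a J) r t, ENNReal.ofReal (‖w x‖ ^ 2) ≤
      ENNReal.ofReal (2 / h) * (ENNReal.ofReal (2 * t) *
          ∫⁻ x in slab J (r + h) t, ENNReal.ofReal (‖w x‖ ^ 2))
        + ENNReal.ofReal (2 * h) * (ENNReal.ofReal (2 * t) *
          ∫⁻ x in slab J (r + h) t, ENNReal.ofReal (‖dD a w x‖ ^ 2)) := by
  have hcw : Continuous fun x => ‖w x‖ ^ 2 := hw.continuous.norm.pow 2
  have hcD : Continuous fun x => ‖dD a w x‖ ^ 2 := ((dD_contDiff hw a).continuous).norm.pow 2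
  have hline : ∀ x : EuclideanSpace ℝ (Fin n), Continuous fun s : ℝ =>
      x + s • (EuclideanSpace.single a 1 : EuclideanSpace ℝ (Fin n)) := fun x =>
    continuous_const.add (continuous_id.smul continuous_const)
  have hpt : ∀ x, ENNReal.ofReal (‖w x‖ ^ 2) ≤
      ENNReal.ofReal (2 / h) * (∫⁻ s in Set.Ioc 0 h,
        ENNReal.ofReal (‖w (x + s • EuclideanSpace.single a 1)‖ ^ 2)) +
      ENNReal.ofReal (2 * h) * (∫⁻ s in Set.Ioc 0 h,
        ENNReal.ofReal (‖dD a w (x + s • EuclideanSpace.single a 1)‖ ^ 2)) := by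
    intro x
    have h1 := oneD (fun s : ℝ => w (x + s • EuclideanSpace.single a 1))
      (fun s : ℝ => dD a w (x + s • EuclideanSpace.single a 1)) (fun s => hasDeriv_line hw a x s)
      (((dD_contDiff hw a).continuous).comp (hline x)) h hh
    rw [intervalIntegral.integral_of_le hh.le, intervalIntegral.integral_of_le hh.le] at h1
    have c1 : Continuous fun s : ℝ => ‖w (x + s • EuclideanSpace.single a 1)‖ ^ 2 :=
      hcw.comp (hline x)
    have c2 : Continuous fun s : ℝ => ‖dD a w (x + s • EuclideanSpace.single a 1)‖ ^ 2 :=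
      hcD.comp (hline x)
    rw [← ofReal_integral_eq_lintegral_ofReal c1.integrableOn_Ioc
      (Filter.Eventually.of_forall fun x => by positivity),
      ← ofReal_integral_eq_lintegral_ofReal c2.integrableOn_Ioc
      (Filter.Eventually.of_forall fun x => by positivity), ← ENNReal.ofReal_mul (by positivity),
      ← ENNReal.ofReal_mul (by positivity), ← ENNReal.ofReal_add]
    · simpa using ENNReal.ofReal_le_ofReal h1
    · exact mul_nonneg (by positivity) (integral_nonneg fun _ => by positivity)
    · exact mul_nonneg (by positivity) (integral_nonneg fun _ => by positivity)
  have m1 : Measurable fun x => ENNReal.ofReal (‖w x‖ ^ 2) := hcw.measurable.ennreal_ofReal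
  have m2 : Measurable fun x => ENNReal.ofReal (‖dD a w x‖ ^ 2) := hcD.measurable.ennreal_ofReal
  have hmm : ∀ G : EuclideanSpace ℝ (Fin n) → ENNReal, Measurable G →
      Measurable fun x => ∫⁻ s in Set.Ioc 0 h, G (x + s • EuclideanSpace.single a 1) := by
    intro G hG
    have hm : Measurable (fun p : EuclideanSpace ℝ (Fin n) × ℝ =>
        G (p.1 + p.2 • EuclideanSpace.single a 1)) := by
      refine hG.comp ?_
      exact (continuous_fst.add (continuous_snd.smul continuous_const)).measurable
    exact hm.lintegral_prod_right'
  calc _ ≤ _ := lintegral_mono hpt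
    _ = _ := by
      rw [lintegral_add_left ((hmm _ m1).const_mul _), lintegral_const_mul _ (hmm _ m1),
        lintegral_const_mul _ (hmm _ m2)]
    _ ≤ _ := by
      gcongr
      · exact slab_fubini J a ha r t h _ m1
      · exact slab_fubini J a ha r t h _ m2

lemma slab_decay {n N : ℕ} (A : Fin n → Fin n → Fin N → Fin N → ℝ)
    (ν : ℝ) (hν : 0 < ν)
    (hell : ∀ ξ : Fin n → Fin N → ℝ,
      ν * (∑ a, ∑ i, (ξ a i) ^ 2) ≤ ∑ a, ∑ b, ∑ i, ∑ j, A a b i j * ξ a i * ξ b j)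
    (J : Finset (Fin n)) : ∀ (r s : ℝ) (_ : 0 < r) (_ : r < s),
    ∃ C : ENNReal, C ≠ ⊤ ∧ ∀ w : EuclideanSpace ℝ (Fin n) → EuclideanSpace ℝ (Fin N), Sol A w s →
      ∀ t : ℝ, 0 < t → ∫⁻ x in slab J r t, ENNReal.ofReal (‖w x‖ ^ 2) ≤
        C * ENNReal.ofReal t ^ J.card *
          ∫⁻ x in ball (0 : EuclideanSpace ℝ (Fin n)) s, ENNReal.ofReal (‖w x‖ ^ 2) := by
  induction J using Finset.induction_on with
  | empty =>
    intro r s hr hrs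
    refine ⟨1, by simp, fun w hw t ht => ?_⟩
    simp only [Finset.card_empty, pow_zero, one_mul]
    exact lintegral_mono_set (Set.inter_subset_left.trans (ball_subset_ball hrs.le))
  | insert a J ha ih =>
    intro r s hr hrs
    set h := (s - r) / 3 with hh
    have hh0 : 0 < h := by rw [hh]; linarith
    obtain ⟨C1, hC1, H1⟩ := ih (r + h) (r + 2 * h) (by linarith) (by linarith)
    obtain ⟨C2, hC2, H2⟩ := cacc' A ν hν hell (r + 2 * h) s (by linarith) (by rw [hh]; linarith)
    refine ⟨ENNReal.ofReal (2 / h) * (ENNReal.ofReal 2 * C1)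
      + ENNReal.ofReal (2 * h) * (ENNReal.ofReal 2 * (C1 * C2)), ?_, fun w hw t ht => ?_⟩
    · finiteness
    · refine (slab_step J a ha r t h hh0 w hw.1).trans ?_
      have hle : r + 2 * h ≤ s := by rw [hh]; linarith
      have e1 := H1 w (hw.mono hle) t ht
      have e2 := H1 (dD a w) ((hw.dD a).mono hle) t ht
      have e3 := H2 w hw a
      have e4 : ∫⁻ x in ball (0 : EuclideanSpace ℝ (Fin n)) (r + 2 * h), ENNReal.ofReal (‖w x‖ ^ 2)
        ≤ ∫⁻ x in ball (0 : EuclideanSpace ℝ (Fin n)) s, ENNReal.ofReal (‖w x‖ ^ 2) :=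
        lintegral_mono_set (ball_subset_ball hle)
      set I := ∫⁻ x in ball (0 : EuclideanSpace ℝ (Fin n)) s, ENNReal.ofReal (‖w x‖ ^ 2)
      have f1 := e1.trans (mul_le_mul_right e4 _)
      have f2 := e2.trans (mul_le_mul_right e3 _)
      calc _ ≤ ENNReal.ofReal (2 / h) * (ENNReal.ofReal (2 * t) *
            (C1 * ENNReal.ofReal t ^ J.card * I))
          + ENNReal.ofReal (2 * h) * (ENNReal.ofReal (2 * t) *
            (C1 * ENNReal.ofReal t ^ J.card * (C2 * I))) := by gcongr
        _ = _ := by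
          rw [Finset.card_insert_of_notMem ha, ENNReal.ofReal_mul (by norm_num : (0:ℝ) ≤ 2),
            pow_succ]
          ring

/-- decay for smooth solutions on the unit ball -/
lemma unit_decay {n N : ℕ} (A : Fin n → Fin n → Fin N → Fin N → ℝ)
    (ν : ℝ) (hν : 0 < ν)
    (hell : ∀ ξ : Fin n → Fin N → ℝ,
      ν * (∑ a, ∑ i, (ξ a i) ^ 2) ≤ ∑ a, ∑ b, ∑ i, ∑ j, A a b i j * ξ a i * ξ b j) :
    ∃ C : ENNReal, C ≠ ⊤ ∧ ∀ w : EuclideanSpace ℝ (Fin n) → EuclideanSpace ℝ (Fin N), Sol A w 1 →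
      ∀ t : ℝ, 0 < t → t ≤ 1 / 2 →
      ∫⁻ x in ball (0 : EuclideanSpace ℝ (Fin n)) t, ENNReal.ofReal (‖w x‖ ^ 2) ≤
        C * ENNReal.ofReal t ^ n *
          ∫⁻ x in ball (0 : EuclideanSpace ℝ (Fin n)) 1, ENNReal.ofReal (‖w x‖ ^ 2) := by
  obtain ⟨C, hC, H⟩ := slab_decay A ν hν hell Finset.univ (1 / 2) 1 (by norm_num) (by norm_num)
  refine ⟨C, hC, fun w hw t ht ht2 => ?_⟩
  have := H w hw t ht
  rw [Finset.card_univ, Fintype.card_fin] at this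
  refine le_trans (lintegral_mono_set ?_) this
  intro x hx
  refine ⟨ball_subset_ball ht2 hx, fun i _ => ?_⟩
  rw [mem_ball_zero_iff] at hx
  exact (PiLp.norm_apply_le x i).trans hx.le


lemma lintegral_scale {n : ℕ} (x₀ : EuclideanSpace ℝ (Fin n)) (R : ℝ) (hR : 0 < R) (ρ : ℝ)
    (f : EuclideanSpace ℝ (Fin n) → ENNReal) (hf : Measurable f) :
    ∫⁻ y in ball (0 : EuclideanSpace ℝ (Fin n)) ρ, f (x₀ + R • y) =
      ENNReal.ofReal ((R ^ n)⁻¹) * ∫⁻ x in ball x₀ (ρ * R), f x := by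
  rw [← lintegral_indicator measurableSet_ball, ← lintegral_indicator measurableSet_ball]
  have h1 : ∀ y, (ball (0 : EuclideanSpace ℝ (Fin n)) ρ).indicator (fun y => f (x₀ + R • y)) y
      = (fun z => (ball x₀ (ρ * R)).indicator f (x₀ + z)) (R • y) := by
    intro y
    have : y ∈ ball (0 : EuclideanSpace ℝ (Fin n)) ρ ↔ x₀ + R • y ∈ ball x₀ (ρ * R) := by
      rw [mem_ball_zero_iff, mem_ball, dist_eq_norm, add_sub_cancel_left, norm_smul,
        Real.norm_eq_abs, abs_of_pos hR, mul_comm, mul_lt_mul_iff_left₀ hR]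
    by_cases hy : y ∈ ball (0 : EuclideanSpace ℝ (Fin n)) ρ
    · simp only [Set.indicator_of_mem hy, Set.indicator_of_mem (this.1 hy)]
    · have hy' := fun h => hy (this.2 h)
      simp only [Set.indicator_of_notMem hy, Set.indicator_of_notMem hy']
  have hm : Measurable (fun z => (ball x₀ (ρ * R)).indicator f (x₀ + z)) :=
    (hf.indicator measurableSet_ball).comp (measurable_const.add measurable_id)
  rw [lintegral_congr h1, ← lintegral_map hm (measurable_const_smul R),
    Measure.map_addHaar_smul volume hR.ne', lintegral_smul_measure,
    lintegral_add_left_eq_self (fun z => (ball x₀ (ρ * R)).indicator f z)]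
  simp only [finrank_euclideanSpace, Fintype.card_fin, smul_eq_mul]
  rw [abs_of_pos (by positivity)]

lemma dD_scale {n N : ℕ} (x₀ : EuclideanSpace ℝ (Fin n)) (R : ℝ)
    (w : EuclideanSpace ℝ (Fin n) → EuclideanSpace ℝ (Fin N)) (hw : ContDiff ℝ (⊤ : ℕ∞) w)
    (a : Fin n) (k : ℝ) :
    dD a (fun y => k • w (x₀ + R • y)) = fun y => (k * R) • dD a w (x₀ + R • y) := by
  funext y
  have h1 : HasFDerivAt (fun y : EuclideanSpace ℝ (Fin n) => x₀ + R • y)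
      (R • ContinuousLinearMap.id ℝ _) y := ((hasFDerivAt_id y).const_smul R).const_add x₀
  have h2 := ((hasFDerivAt_of_smooth hw (x₀ + R • y)).comp y h1).const_smul k
  unfold dD
  have h3 : fderiv ℝ (fun y => k • w (x₀ + R • y)) y
    = k • (fderiv ℝ w (x₀ + R • y)).comp (R • ContinuousLinearMap.id ℝ _) := h2.fderiv
  rw [h3]
  simp [mul_smul]

/-- decay for smooth solutions on any ball -/
lemma ball_decay {n N : ℕ} (A : Fin n → Fin n → Fin N → Fin N → ℝ)
    (ν : ℝ) (hν : 0 < ν)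
    (hell : ∀ ξ : Fin n → Fin N → ℝ,
      ν * (∑ a, ∑ i, (ξ a i) ^ 2) ≤ ∑ a, ∑ b, ∑ i, ∑ j, A a b i j * ξ a i * ξ b j) :
    ∃ C : ENNReal, C ≠ ⊤ ∧ ∀ (x₀ : EuclideanSpace ℝ (Fin n)) (R : ℝ), 0 < R →
      ∀ u : EuclideanSpace ℝ (Fin n) → EuclideanSpace ℝ (Fin N),
      ContDiff ℝ (⊤ : ℕ∞) u →
      (∀ x ∈ ball x₀ R, ∀ i, ∑ a, ∑ b, ∑ j, A a b i j * dD a (dD b u) x j = 0) →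
      ∀ c, ∀ t : ℝ, 0 < t → t ≤ 1 / 2 →
      ∫⁻ x in ball x₀ (t * R), ENNReal.ofReal (‖dD c u x‖ ^ 2) ≤
        C * ENNReal.ofReal t ^ n * ∫⁻ x in ball x₀ R, ENNReal.ofReal (‖dD c u x‖ ^ 2) := by
  obtain ⟨C, hC, H⟩ := unit_decay A ν hν hell
  refine ⟨C, hC, fun x₀ R hR u hu hpde c t ht ht2 => ?_⟩
  have hs : Sol A (fun y => R⁻¹ • u (x₀ + R • y)) 1 := by
    have haff : ContDiff ℝ (⊤ : ℕ∞) fun y : EuclideanSpace ℝ (Fin n) => x₀ + R • y :=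
      by fun_prop
    refine ⟨ContDiff.const_smul R⁻¹ (hu.comp haff), fun x hx i => ?_⟩
    have hx' : x₀ + R • x ∈ ball x₀ R := by
      rw [mem_ball_zero_iff] at hx
      rw [mem_ball, dist_eq_norm, add_sub_cancel_left, norm_smul,
        Real.norm_eq_abs, abs_of_pos hR]
      nlinarith
    have h1 := hpde _ hx' i
    have h2 : ∀ a b, dD a (dD b fun y => R⁻¹ • u (x₀ + R • y)) x
        = R • dD a (dD b u) (x₀ + R • x) := by
      intro a b
      rw [dD_scale x₀ R u hu, dD_scale x₀ R (dD b u) (dD_contDiff hu b), inv_mul_cancel₀ hR.ne',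
        one_mul]
    simp only [h2, PiLp.smul_apply, smul_eq_mul]
    have h3 : ∀ a b j, A a b i j * (R * dD a (dD b u) (x₀ + R • x) j)
      = R * (A a b i j * dD a (dD b u) (x₀ + R • x) j) := fun a b j => by ring
    simp only [h3, ← Finset.mul_sum, h1, mul_zero]
  have h4 := H _ (hs.dD c) t ht ht2
  rw [dD_scale x₀ R u hu, inv_mul_cancel₀ hR.ne'] at h4
  simp only [one_smul] at h4
  have hm : Measurable fun x => ENNReal.ofReal (‖dD c u x‖ ^ 2) :=
    (((dD_contDiff hu c).continuous).norm.pow 2).measurable.ennreal_ofReal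
  rw [lintegral_scale x₀ R hR t _ hm, lintegral_scale x₀ R hR 1 _ hm, one_mul,
    mul_left_comm] at h4
  have k0 : ENNReal.ofReal ((R ^ n)⁻¹) ≠ 0 := by
    simp only [ne_eq, ENNReal.ofReal_eq_zero, not_le]; positivity
  exact (ENNReal.mul_le_mul_iff_right k0 ENNReal.ofReal_ne_top).1 h4


section mollify
variable {n N : ℕ}

/-- mollification `x ↦ ∫ ρ (x - t) • u t` -/
def cv (u : EuclideanSpace ℝ (Fin n) → EuclideanSpace ℝ (Fin N))
    (ρ : EuclideanSpace ℝ (Fin n) → ℝ) : EuclideanSpace ℝ (Fin n) → EuclideanSpace ℝ (Fin N) :=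
  convolution u ρ (ContinuousLinearMap.lsmul ℝ ℝ).flip volume

lemma cv_apply (u : EuclideanSpace ℝ (Fin n) → EuclideanSpace ℝ (Fin N))
    (ρ : EuclideanSpace ℝ (Fin n) → ℝ) (x) : cv u ρ x = ∫ t, ρ (x - t) • u t := rfl

lemma dD_tsupport {ρ : EuclideanSpace ℝ (Fin n) → ℝ} (a : Fin n) :
    tsupport (dD a ρ) ⊆ tsupport ρ := by
  refine (closure_mono ?_).trans (closure_minimal (support_fderiv_subset ℝ (f := ρ))
    (isClosed_tsupport _))
  intro x hx h
  apply hx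
  simp [dD, h]

lemma cv_contDiff {u : EuclideanSpace ℝ (Fin n) → EuclideanSpace ℝ (Fin N)}
    {ρ : EuclideanSpace ℝ (Fin n) → ℝ} (hu : Continuous u) (hρ : ContDiff ℝ (⊤ : ℕ∞) ρ)
    (hc : HasCompactSupport ρ) : ContDiff ℝ (⊤ : ℕ∞) (cv u ρ) :=
  hc.contDiff_convolution_right _ hu.locallyIntegrable hρ

lemma cv_dD {u : EuclideanSpace ℝ (Fin n) → EuclideanSpace ℝ (Fin N)}
    {ρ : EuclideanSpace ℝ (Fin n) → ℝ} (hu : Continuous u) (hρ : ContDiff ℝ (⊤ : ℕ∞) ρ)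
    (hc : HasCompactSupport ρ) (a : Fin n) : dD a (cv u ρ) = cv u (dD a ρ) := by
  funext x
  have lu : LocallyIntegrable u volume := hu.locallyIntegrable
  have h1 := (hc.hasFDerivAt_convolution_right (ContinuousLinearMap.lsmul ℝ ℝ).flip
    lu (hρ.of_le (by exact_mod_cast le_top)) x).fderiv
  have h2 : fderiv ℝ (cv u ρ) x = _ := h1
  unfold dD
  rw [h2, convolution_precompR_apply _ lu (hc.fderiv ℝ)
    (hρ.continuous_fderiv (by simp))]
  rfl

lemma sub_notMem {ρ : EuclideanSpace ℝ (Fin n) → ℝ} {ε R : ℝ} {x x₀ : EuclideanSpace ℝ (Fin n)}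
    (hs : tsupport ρ ⊆ closedBall 0 ε) (hx : closedBall x ε ⊆ ball x₀ R)
    (t) (ht : t ∉ ball x₀ R) : ρ (x - t) = 0 := by
  refine image_eq_zero_of_notMem_tsupport fun h => ht (hx ?_)
  have := hs h
  rw [mem_closedBall_zero_iff] at this
  rwa [mem_closedBall, dist_comm, dist_eq_norm]

lemma moll_integrable {F : Type*} [NormedAddCommGroup F] [NormedSpace ℝ F]
    {ρ : EuclideanSpace ℝ (Fin n) → ℝ} {ε R : ℝ} {x x₀ : EuclideanSpace ℝ (Fin n)}
    (hρ : Continuous ρ) (hc : HasCompactSupport ρ)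
    (hs : tsupport ρ ⊆ closedBall 0 ε) (hx : closedBall x ε ⊆ ball x₀ R)
    {g : EuclideanSpace ℝ (Fin n) → F} (hg : IntegrableOn g (ball x₀ R)) :
    Integrable (fun t => ρ (x - t) • g t) := by
  obtain ⟨C, hC⟩ := hc.exists_bound_of_continuous hρ
  have h1 : IntegrableOn (fun t => ρ (x - t) • g t) (ball x₀ R) :=
    Integrable.bdd_smul hg C (hρ.comp (continuous_const.sub continuous_id)).aestronglyMeasurable
      (Filter.Eventually.of_forall fun t => hC _)
  refine h1.integrable_of_forall_notMem_eq_zero fun t ht => ?_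
  rw [sub_notMem hs hx t ht, zero_smul]

lemma refl_dD {ρ : EuclideanSpace ℝ (Fin n) → ℝ} (hρ : ContDiff ℝ (⊤ : ℕ∞) ρ)
    (x t : EuclideanSpace ℝ (Fin n)) (a : Fin n) :
    fderiv ℝ (fun t => ρ (x - t)) t (EuclideanSpace.single a 1) = - dD a ρ (x - t) := by
  have h1 : HasFDerivAt (fun t => x - t) (-ContinuousLinearMap.id ℝ (EuclideanSpace ℝ (Fin n))) t :=
    (hasFDerivAt_id t).const_sub x
  have h2 := ((hasFDerivAt_of_smooth hρ (x - t)).comp t h1).fderiv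
  have h3 : fderiv ℝ (fun t => ρ (x - t)) t = _ := h2
  rw [h3]
  simp [dD]

lemma cv_ibp {u : EuclideanSpace ℝ (Fin n) → EuclideanSpace ℝ (Fin N)}
    {ρ : EuclideanSpace ℝ (Fin n) → ℝ} {ε R : ℝ} {x x₀ : EuclideanSpace ℝ (Fin n)}
    (hu : Differentiable ℝ u) (hρ : ContDiff ℝ (⊤ : ℕ∞) ρ) (hc : HasCompactSupport ρ)
    (hs : tsupport ρ ⊆ closedBall 0 ε) (hx : closedBall x ε ⊆ ball x₀ R) (b : Fin n)
    (hg : IntegrableOn (dD b u) (ball x₀ R)) :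
    cv u (dD b ρ) x = ∫ t, ρ (x - t) • dD b u t := by
  have hub : IntegrableOn u (ball x₀ R) :=
    (hu.continuous.locallyIntegrable.integrableOn_isCompact (isCompact_closedBall x₀ R)).mono_set
      ball_subset_closedBall
  have hdc : HasCompactSupport (dD b ρ) := hc.mono' (subset_closure.trans (dD_tsupport b))
  have i1 := moll_integrable (x := x) (dD_contDiff hρ b).continuous hdc ((dD_tsupport b).trans hs) hx hub
  have h := integral_smul_fderiv_eq_neg_fderiv_smul_of_integrable (μ := volume)
    (f := fun t => ρ (x - t)) (g := u) (v := EuclideanSpace.single b 1)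
    (by
      simp only [refl_dD hρ, neg_smul]
      exact i1.neg)
    (moll_integrable hρ.continuous hc hs hx hg)
    (moll_integrable hρ.continuous hc hs hx hub)
    (fun t _ => ((hρ.differentiable (by simp)).comp
      ((differentiable_const x).sub differentiable_id)) t) (fun t _ => hu t)
  simp only [refl_dD hρ, neg_smul, integral_neg, neg_neg] at h
  rw [cv_apply, ← h]
  rfl

lemma cv_pde {A : Fin n → Fin n → Fin N → Fin N → ℝ}
    {u : EuclideanSpace ℝ (Fin n) → EuclideanSpace ℝ (Fin N)}
    {ρ : EuclideanSpace ℝ (Fin n) → ℝ} {ε R : ℝ} {x x₀ : EuclideanSpace ℝ (Fin n)}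
    (hu : Differentiable ℝ u) (hρ : ContDiff ℝ (⊤ : ℕ∞) ρ) (hc : HasCompactSupport ρ)
    (hs : tsupport ρ ⊆ closedBall 0 ε) (hx : closedBall x ε ⊆ ball x₀ R)
    (hg : ∀ b, IntegrableOn (dD b u) (ball x₀ R))
    (hweak : ∀ φ : EuclideanSpace ℝ (Fin n) → EuclideanSpace ℝ (Fin N),
            ContDiff ℝ (⊤ : ℕ∞) φ → HasCompactSupport φ → tsupport φ ⊆ Metric.ball x₀ R →
            ∫ x in Metric.ball x₀ R,
              ∑ a, ∑ b, ∑ i, ∑ j, A a b i j * pD n N u x b j * pD n N φ x a i = 0) (i : Fin N) :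
    ∑ a, ∑ b, ∑ j, A a b i j * dD a (dD b (cv u ρ)) x j = 0 := by
  have hdc : ∀ a, HasCompactSupport (dD a ρ) :=
    fun a => hc.mono' (subset_closure.trans (dD_tsupport a))
  have hInt : ∀ a b, Integrable (fun t => dD a ρ (x - t) • dD b u t) := fun a b =>
    moll_integrable (dD_contDiff hρ a).continuous (hdc a) ((dD_tsupport a).trans hs) hx (hg b)
  have hintj : ∀ a b j, Integrable (fun t => dD a ρ (x - t) * dD b u t j) := fun a b j =>
    (EuclideanSpace.proj (𝕜 := ℝ) j : EuclideanSpace ℝ (Fin N) →L[ℝ] ℝ).integrable_comp (hInt a b)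
  have h1 : ∀ a b j, dD a (dD b (cv u ρ)) x j = ∫ t, dD a ρ (x - t) * dD b u t j := by
    intro a b j
    rw [cv_dD hu.continuous hρ hc b, cv_dD hu.continuous (dD_contDiff hρ b) (hdc b) a,
      dD_comm hρ a b, cv_ibp hu (dD_contDiff hρ a) (hdc a) ((dD_tsupport a).trans hs) hx b (hg b)]
    exact ((EuclideanSpace.proj (𝕜 := ℝ) j : EuclideanSpace ℝ (Fin N) →L[ℝ] ℝ).integral_comp_comm
      (hInt a b)).symm
  have h2 : ∑ a, ∑ b, ∑ j, A a b i j * dD a (dD b (cv u ρ)) x j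
      = ∫ t, ∑ a, ∑ b, ∑ j, A a b i j * (dD a ρ (x - t) * dD b u t j) := by
    rw [integral_finsetSum _ fun a _ => integrable_finsetSum _ fun b _ =>
      integrable_finsetSum _ fun j _ => (hintj a b j).const_mul _]
    refine Finset.sum_congr rfl fun a _ => ?_
    rw [integral_finsetSum _ fun b _ => integrable_finsetSum _ fun j _ => (hintj a b j).const_mul _]
    refine Finset.sum_congr rfl fun b _ => ?_
    rw [integral_finsetSum _ fun j _ => (hintj a b j).const_mul _]
    refine Finset.sum_congr rfl fun j _ => ?_
    rw [h1, integral_const_mul]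
  have hsub : ContDiff ℝ (⊤ : ℕ∞) (fun t => ρ (x - t)) :=
    hρ.comp (contDiff_const.sub contDiff_id)
  let φ : EuclideanSpace ℝ (Fin n) → EuclideanSpace ℝ (Fin N) :=
    fun t => ρ (x - t) • EuclideanSpace.single i 1
  have hφ : ContDiff ℝ (⊤ : ℕ∞) φ := hsub.smul contDiff_const
  have hφs : tsupport φ ⊆ closedBall x ε := by
    refine closure_minimal ?_ isClosed_closedBall
    intro t ht
    by_contra h
    apply ht
    have : ρ (x - t) = 0 := by
      refine image_eq_zero_of_notMem_tsupport fun h' => h ?_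
      have := hs h'
      rw [mem_closedBall_zero_iff] at this
      rwa [mem_closedBall, dist_comm, dist_eq_norm]
    simp [φ, this]
  have hφc : HasCompactSupport φ := (isCompact_closedBall x ε).of_isClosed_subset
    (isClosed_tsupport _) hφs
  have hpφ : ∀ t a k, pD n N φ t a k = - dD a ρ (x - t) * (if k = i then 1 else 0) := by
    intro t a k
    have : fderiv ℝ φ t = _ := fderiv_smul_const (hsub.differentiable (by simp) t) _
    unfold pD
    rw [this]
    simp only [ContinuousLinearMap.smulRight_apply, refl_dD hρ, PiLp.smul_apply, smul_eq_mul]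
    congr 1
    by_cases h : k = i
    · subst h; simp
    · simp [h]
  have h3 := hweak φ hφ hφc (hφs.trans hx)
  rw [setIntegral_eq_integral_of_forall_compl_eq_zero] at h3
  · rw [h2]
    have h4 : ∀ t, ∑ a, ∑ b, ∑ j, A a b i j * (dD a ρ (x - t) * dD b u t j)
        = - ∑ a, ∑ b, ∑ k, ∑ j, A a b k j * pD n N u t b j * pD n N φ t a k := by
      intro t
      simp only [hpφ, ← Finset.sum_neg_distrib]
      refine Finset.sum_congr rfl fun a _ => Finset.sum_congr rfl fun b _ => ?_
      symm
      rw [Finset.sum_eq_single i]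
      · refine Finset.sum_congr rfl fun j _ => ?_
        simp only [pD, dD, if_true]
        ring
      · intro k _ hk
        simp [hk]
      · simp
    simp only [h4, integral_neg, h3, neg_zero]
  · intro t ht
    have : ∀ a, dD a ρ (x - t) = 0 := fun a => sub_notMem ((dD_tsupport a).trans hs) hx t ht
    simp [hpφ, this]

lemma jensen_pt {ρ : EuclideanSpace ℝ (Fin n) → ℝ} (hρ : Continuous ρ) (hc : HasCompactSupport ρ)
    (h0 : ∀ x, 0 ≤ ρ x) (h1 : ∫ x, ρ x = 1)
    {g : EuclideanSpace ℝ (Fin n) → EuclideanSpace ℝ (Fin N)} (hg : Integrable g)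
    (hg2 : Integrable fun x => ‖g x‖ ^ 2) (x) :
    ‖cv g ρ x‖ ^ 2 ≤ ∫ t, ρ (x - t) * ‖g t‖ ^ 2 := by
  obtain ⟨C, hC⟩ := hc.exists_bound_of_continuous hρ
  have hρm : AEStronglyMeasurable (fun t => ρ (x - t)) volume :=
    (hρ.comp (continuous_const.sub continuous_id)).aestronglyMeasurable
  have i1 : Integrable fun t => ρ (x - t) * ‖g t‖ :=
    hg.norm.bdd_mul hρm (Filter.Eventually.of_forall fun t => hC _)
  have i2 : Integrable fun t => ρ (x - t) * ‖g t‖ ^ 2 :=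
    hg2.bdd_mul hρm (Filter.Eventually.of_forall fun t => hC _)
  have i0 : Integrable fun t => ρ (x - t) :=
    (hρ.integrable_of_hasCompactSupport hc).comp_sub_left x
  have e0 : ∫ t, ρ (x - t) = 1 := by rw [integral_sub_left_eq_self ρ volume x, h1]
  set k := ∫ t, ρ (x - t) * ‖g t‖ with hk
  have hle : ‖cv g ρ x‖ ≤ k := by
    rw [cv_apply]
    refine (norm_integral_le_integral_norm _).trans (le_of_eq ?_)
    refine integral_congr_ae (Filter.Eventually.of_forall fun t => ?_)
    simp [norm_smul, abs_of_nonneg (h0 _)]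
  have hpos : 0 ≤ ∫ t, ρ (x - t) * (‖g t‖ - k) ^ 2 :=
    integral_nonneg fun t => mul_nonneg (h0 _) (sq_nonneg _)
  have hexp : ∫ t, ρ (x - t) * (‖g t‖ - k) ^ 2
      = (∫ t, ρ (x - t) * ‖g t‖ ^ 2) - 2 * k * k + k ^ 2 := by
    have : ∀ t, ρ (x - t) * (‖g t‖ - k) ^ 2
      = ρ (x - t) * ‖g t‖ ^ 2 - 2 * k * (ρ (x - t) * ‖g t‖) + k ^ 2 * ρ (x - t) := fun t => by ring
    simp only [this]
    have i3 : Integrable fun t => ρ (x - t) * ‖g t‖ ^ 2 - 2 * k * (ρ (x - t) * ‖g t‖) :=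
      i2.sub (i1.const_mul _)
    rw [integral_add i3 (i0.const_mul _), integral_sub i2 (i1.const_mul _),
      integral_const_mul, integral_const_mul, e0, ← hk, mul_one]
  nlinarith [norm_nonneg (cv g ρ x)]

lemma jensen {ρ : EuclideanSpace ℝ (Fin n) → ℝ} (hρ : Continuous ρ) (hc : HasCompactSupport ρ)
    (h0 : ∀ x, 0 ≤ ρ x) (h1 : ∫ x, ρ x = 1)
    {g : EuclideanSpace ℝ (Fin n) → EuclideanSpace ℝ (Fin N)} (hg : Integrable g)
    (hgm : Measurable g) (hg2 : Integrable fun x => ‖g x‖ ^ 2) :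
    ∫⁻ x, ENNReal.ofReal (‖cv g ρ x‖ ^ 2) ≤ ∫⁻ x, ENNReal.ofReal (‖g x‖ ^ 2) := by
  obtain ⟨C, hC⟩ := hc.exists_bound_of_continuous hρ
  have hpt : ∀ x, ENNReal.ofReal (‖cv g ρ x‖ ^ 2)
      ≤ ∫⁻ t, ENNReal.ofReal (ρ (x - t)) * ENNReal.ofReal (‖g t‖ ^ 2) := by
    intro x
    have i2 : Integrable fun t => ρ (x - t) * ‖g t‖ ^ 2 :=
      hg2.bdd_mul (hρ.comp (continuous_const.sub continuous_id)).aestronglyMeasurable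
        (Filter.Eventually.of_forall fun t => hC _)
    simp only [← ENNReal.ofReal_mul (h0 _)]
    rw [← ofReal_integral_eq_lintegral_ofReal i2
      (Filter.Eventually.of_forall fun t => mul_nonneg (h0 _) (sq_nonneg _))]
    exact ENNReal.ofReal_le_ofReal (jensen_pt hρ hc h0 h1 hg hg2 x)
  have hm : Measurable fun p : EuclideanSpace ℝ (Fin n) × EuclideanSpace ℝ (Fin n) =>
      ENNReal.ofReal (ρ (p.1 - p.2)) * ENNReal.ofReal (‖g p.2‖ ^ 2) :=
    ((hρ.comp (continuous_fst.sub continuous_snd)).measurable.ennreal_ofReal).mul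
      (((hgm.norm.pow_const 2).ennreal_ofReal).comp measurable_snd)
  calc _ ≤ _ := lintegral_mono hpt
    _ = _ := lintegral_lintegral_swap hm.aemeasurable
    _ = _ := by
      refine lintegral_congr fun t => ?_
      have hmρ : Measurable fun x => ENNReal.ofReal (ρ (x - t)) :=
        (hρ.comp (continuous_id.sub continuous_const)).measurable.ennreal_ofReal
      rw [lintegral_mul_const _ hmρ, lintegral_sub_right_eq_self (fun x => ENNReal.ofReal (ρ x)),
        ← ofReal_integral_eq_lintegral_ofReal (hρ.integrable_of_hasCompactSupport hc)
        (Filter.Eventually.of_forall h0), h1]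
      simp

end mollify


section final
variable {n N : ℕ}

lemma sum_dD_sq (u : EuclideanSpace ℝ (Fin n) → EuclideanSpace ℝ (Fin N)) (x) :
    ∑ b, ‖dD b u x‖ ^ 2 = gradSq n N u x := by
  unfold gradSq
  refine Finset.sum_congr rfl fun b _ => ?_
  rw [EuclideanSpace.real_norm_sq_eq]
  rfl

lemma dD_sq_le (u : EuclideanSpace ℝ (Fin n) → EuclideanSpace ℝ (Fin N)) (x) (b : Fin n) :
    ‖dD b u x‖ ^ 2 ≤ gradSq n N u x := by
  rw [← sum_dD_sq]
  exact Finset.single_le_sum (f := fun b => ‖dD b u x‖ ^ 2) (fun _ _ => sq_nonneg _)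
    (Finset.mem_univ b)

lemma dD_measurable (u : EuclideanSpace ℝ (Fin n) → EuclideanSpace ℝ (Fin N)) (b : Fin n) :
    Measurable (dD b u) := measurable_fderiv_apply_const ℝ u _

lemma gradSq_nonneg (u : EuclideanSpace ℝ (Fin n) → EuclideanSpace ℝ (Fin N)) (x) :
    0 ≤ gradSq n N u x :=
  Finset.sum_nonneg fun _ _ => Finset.sum_nonneg fun _ _ => sq_nonneg _

lemma weak_decay_b (A : Fin n → Fin n → Fin N → Fin N → ℝ) (ν : ℝ) (hν : 0 < ν)
    (hell : ∀ ξ : Fin n → Fin N → ℝ,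
      ν * (∑ a, ∑ i, (ξ a i) ^ 2) ≤ ∑ a, ∑ b, ∑ i, ∑ j, A a b i j * ξ a i * ξ b j) :
    ∃ C : ENNReal, C ≠ ⊤ ∧ ∀ (x₀ : EuclideanSpace ℝ (Fin n)) (R : ℝ), 0 < R →
        ∀ u : EuclideanSpace ℝ (Fin n) → EuclideanSpace ℝ (Fin N),
          Differentiable ℝ u →
          IntegrableOn (fun x => gradSq n N u x) (Metric.ball x₀ R) volume →
          (∀ φ : EuclideanSpace ℝ (Fin n) → EuclideanSpace ℝ (Fin N),
            ContDiff ℝ (⊤ : ℕ∞) φ → HasCompactSupport φ → tsupport φ ⊆ Metric.ball x₀ R →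
            ∫ x in Metric.ball x₀ R,
              ∑ a, ∑ b, ∑ i, ∑ j, A a b i j * pD n N u x b j * pD n N φ x a i = 0) →
          ∀ c : Fin n, ∀ τ : ℝ, 0 < τ → τ ≤ 1 / 2 →
            ∫⁻ x in ball x₀ (τ * (R / 2)), ENNReal.ofReal (‖dD c u x‖ ^ 2) ≤
              C * ENNReal.ofReal τ ^ n * ∫⁻ x in ball x₀ R, ENNReal.ofReal (‖dD c u x‖ ^ 2) := by
  obtain ⟨C, hC, hdec⟩ := ball_decay A ν hν hell
  refine ⟨C, hC, fun x₀ R hR u hu hInt hweak c τ hτ hτ2 => ?_⟩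
  have h2 : ∀ b, IntegrableOn (fun x => ‖dD b u x‖ ^ 2) (ball x₀ R) := fun b =>
    Integrable.mono' hInt ((dD_measurable u b).norm.pow_const 2).aestronglyMeasurable
      (Filter.Eventually.of_forall fun x => by
        rw [Real.norm_of_nonneg (sq_nonneg _)]; exact dD_sq_le u x b)
  have hg : ∀ b, IntegrableOn (dD b u) (ball x₀ R) := fun b => by
    have h1 : IntegrableOn (fun _ : EuclideanSpace ℝ (Fin n) => (1 : ℝ)) (ball x₀ R) :=
      integrableOn_const measure_ball_lt_top.ne
    refine Integrable.mono' (h1.add (h2 b)) (dD_measurable u b).aestronglyMeasurable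
      (Filter.Eventually.of_forall fun x => ?_)
    show ‖dD b u x‖ ≤ 1 + ‖dD b u x‖ ^ 2
    nlinarith [sq_nonneg (‖dD b u x‖ - 1), norm_nonneg (dD b u x)]
  set g : EuclideanSpace ℝ (Fin n) → EuclideanSpace ℝ (Fin N) :=
    (ball x₀ R).indicator (dD c u) with hgdef
  have hgi : Integrable g := (integrable_indicator_iff measurableSet_ball).2 (hg c)
  have hgm : Measurable g := (dD_measurable u c).indicator measurableSet_ball
  have hgsq : (fun x => ‖g x‖ ^ 2) = (ball x₀ R).indicator (fun x => ‖dD c u x‖ ^ 2) := by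
    funext x
    by_cases hx : x ∈ ball x₀ R <;> simp [g, Set.indicator, hx]
  have hg2 : Integrable fun x => ‖g x‖ ^ 2 := by
    rw [hgsq]; exact (integrable_indicator_iff measurableSet_ball).2 (h2 c)
  have hgl : ∫⁻ x, ENNReal.ofReal (‖g x‖ ^ 2)
      = ∫⁻ x in ball x₀ R, ENNReal.ofReal (‖dD c u x‖ ^ 2) := by
    rw [← lintegral_indicator measurableSet_ball]
    refine lintegral_congr fun x => ?_
    by_cases hx : x ∈ ball x₀ R <;> simp [g, Set.indicator, hx]
  have hδ : ∀ k : ℕ, 0 < (R / 4) / ((k : ℝ) + 1) := fun k => by positivity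
  let φ : ℕ → ContDiffBump (0 : EuclideanSpace ℝ (Fin n)) := fun k =>
    ⟨(R / 4) / ((k : ℝ) + 1) / 2, (R / 4) / ((k : ℝ) + 1), half_pos (hδ k), half_lt_self (hδ k)⟩
  have hφlim : Filter.Tendsto (fun k => (φ k).rOut) Filter.atTop (nhds 0) := by
    have := (tendsto_one_div_add_atTop_nhds_zero_nat (𝕜 := ℝ)).const_mul (R / 4)
    simp only [mul_zero, mul_one_div] at this
    exact this
  have hae := ContDiffBump.ae_convolution_tendsto_right_of_locallyIntegrable (K := 2)
    (μ := volume) hφlim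
    (Filter.Eventually.of_forall fun k => le_of_eq (by simp only [φ]; ring)) hgi.locallyIntegrable
  let ψ : ℕ → EuclideanSpace ℝ (Fin n) → ℝ := fun k => (φ k).normed volume
  have hψ : ∀ k, ContDiff ℝ (⊤ : ℕ∞) (ψ k) := fun k => (φ k).contDiff_normed
  have hψc : ∀ k, HasCompactSupport (ψ k) := fun k => (φ k).hasCompactSupport_normed
  have hψs : ∀ k, tsupport (ψ k) ⊆ closedBall 0 (φ k).rOut := fun k =>
    ((φ k).tsupport_normed_eq (μ := volume)).le
  have hsub : ∀ k, ∀ x ∈ ball x₀ (R / 2), closedBall x (φ k).rOut ⊆ ball x₀ R := by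
    intro k x hx
    apply closedBall_subset_ball'
    have : (φ k).rOut ≤ R / 4 := div_le_self (by positivity) (by simp)
    rw [mem_ball] at hx
    linarith
  have hcv : ∀ k, ∀ x ∈ ball x₀ (R / 2), dD c (cv u (ψ k)) x = cv g (ψ k) x := by
    intro k x hx
    rw [cv_dD hu.continuous (hψ k) (hψc k), cv_ibp hu (hψ k) (hψc k) (hψs k) (hsub k x hx) c (hg c),
      cv_apply]
    refine integral_congr_ae (Filter.Eventually.of_forall fun t => ?_)
    by_cases ht : t ∈ ball x₀ R
    · simp [g, ht]
    · simp only [sub_notMem (hψs k) (hsub k x hx) t ht, zero_smul]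
  have hss : ball x₀ (τ * (R / 2)) ⊆ ball x₀ (R / 2) := ball_subset_ball (by nlinarith)
  have hkey : ∀ k, ∫⁻ x in ball x₀ (τ * (R / 2)), ENNReal.ofReal (‖cv g (ψ k) x‖ ^ 2) ≤
      C * ENNReal.ofReal τ ^ n * ∫⁻ x in ball x₀ R, ENNReal.ofReal (‖dD c u x‖ ^ 2) := by
    intro k
    have h := hdec x₀ (R / 2) (half_pos hR) (cv u (ψ k)) (cv_contDiff hu.continuous (hψ k) (hψc k))
      (fun x hx i => cv_pde hu (hψ k) (hψc k) (hψs k) (hsub k x hx) hg hweak i) c τ hτ hτ2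
    rw [setLIntegral_congr_fun (g := fun x => ENNReal.ofReal (‖cv g (ψ k) x‖ ^ 2)) measurableSet_ball
        (fun x hx => by simp only [hcv k x (hss hx)]),
      setLIntegral_congr_fun (s := ball x₀ (R / 2))
        (g := fun x => ENNReal.ofReal (‖cv g (ψ k) x‖ ^ 2)) measurableSet_ball
        (fun x hx => by simp only [hcv k x hx])] at h
    refine h.trans (mul_le_mul' le_rfl ?_)
    refine (setLIntegral_le_lintegral _ _).trans ?_
    rw [← hgl]
    exact jensen (hψ k).continuous (hψc k) (fun x => (φ k).nonneg_normed x)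
      (φ k).integral_normed hgi hgm hg2
  have hcont : ∀ k, Continuous (cv g (ψ k)) := fun k =>
    (hψc k).continuous_convolution_right _ hgi.locallyIntegrable (hψ k).continuous
  have hlim : ∀ᵐ x ∂(volume.restrict (ball x₀ (τ * (R / 2)))), ENNReal.ofReal (‖dD c u x‖ ^ 2)
      = Filter.liminf (fun k => ENNReal.ofReal (‖cv g (ψ k) x‖ ^ 2)) Filter.atTop := by
    filter_upwards [ae_restrict_of_ae hae, ae_restrict_mem measurableSet_ball] with x hx hxb
    have hxR : x ∈ ball x₀ R := ball_subset_ball (by linarith) (hss hxb)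
    have h1 : Filter.Tendsto (fun k => cv g (ψ k) x) Filter.atTop (nhds (dD c u x)) := by
      have e : g x = dD c u x := by simp [g, hxR]
      rw [← e]
      refine hx.congr fun k => ?_
      exact congrFun (convolution_flip (μ := volume) (L := ContinuousLinearMap.lsmul ℝ ℝ)
        (f := ψ k) (g := g)).symm x
    exact (ENNReal.tendsto_ofReal (h1.norm.pow 2)).liminf_eq.symm
  rw [lintegral_congr_ae hlim]
  refine (lintegral_liminf_le fun k => ((hcont k).measurable.norm.pow_const 2).ennreal_ofReal).trans ?_
  refine Filter.liminf_le_of_le ?_ fun b hb => ?_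
  · isBoundedDefault
  · obtain ⟨k, hk⟩ := hb.exists
    exact hk.trans (hkey k)

end final

/-- **Campanato's lemma.** Let `A^{αβ}_{ij}` be constants satisfying the
ellipticity condition `ν|ξ|² ≤ A^{αβ}_{ij} ξ^i_α ξ^j_β` with `ν > 0`. Then there exists
`c > 0` (depending only on `n, N, ν` and the coefficients) such that every weak solution
`u ∈ W^{1,2}(B(x₀,R); ℝᴺ)` of `D_α(A^{αβ}_{ij} D_β u^j) = 0` satisfies
`∫_{B(x₀,tR)} |Du|² ≤ c t^n ∫_{B(x₀,R)} |Du|²` for all `t ∈ (0,1]`. -/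
theorem constant_coefficient_decay
    (n N : ℕ) (A : Fin n → Fin n → Fin N → Fin N → ℝ)
    (ν : ℝ) (hν : 0 < ν)
    (hell : ∀ ξ : Fin n → Fin N → ℝ,
      ν * (∑ a, ∑ i, (ξ a i) ^ 2) ≤ ∑ a, ∑ b, ∑ i, ∑ j, A a b i j * ξ a i * ξ b j) :
    ∃ c : ℝ, 0 < c ∧
      ∀ (x₀ : EuclideanSpace ℝ (Fin n)) (R : ℝ), 0 < R →
        ∀ u : EuclideanSpace ℝ (Fin n) → EuclideanSpace ℝ (Fin N),
          Differentiable ℝ u →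
          IntegrableOn (fun x => gradSq n N u x) (Metric.ball x₀ R) volume →
          (∀ φ : EuclideanSpace ℝ (Fin n) → EuclideanSpace ℝ (Fin N),
            ContDiff ℝ (⊤ : ℕ∞) φ → HasCompactSupport φ → tsupport φ ⊆ Metric.ball x₀ R →
            ∫ x in Metric.ball x₀ R,
              ∑ a, ∑ b, ∑ i, ∑ j, A a b i j * pD n N u x b j * pD n N φ x a i = 0) →
          ∀ t : ℝ, 0 < t → t ≤ 1 →
            ∫ x in Metric.ball x₀ (t * R), gradSq n N u x ≤
              c * t ^ n * ∫ x in Metric.ball x₀ R, gradSq n N u x := by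
  obtain ⟨C, hC, hdec⟩ := weak_decay_b A ν hν hell
  refine ⟨C.toReal * 2 ^ n + 4 ^ n, by positivity, fun x₀ R hR u hu hInt hweak t ht ht1 => ?_⟩
  have hI : 0 ≤ ∫ x in ball x₀ R, gradSq n N u x := integral_nonneg fun x => gradSq_nonneg u x
  have hsub : ball x₀ (t * R) ⊆ ball x₀ R := ball_subset_ball (by nlinarith)
  rcases le_or_gt t (1 / 4) with h4 | h4
  · have hlin : ∀ r, IntegrableOn (fun x => gradSq n N u x) (ball x₀ r) →
        ENNReal.ofReal (∫ x in ball x₀ r, gradSq n N u x)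
          = ∑ b, ∫⁻ x in ball x₀ r, ENNReal.ofReal (‖dD b u x‖ ^ 2) := by
      intro r hr
      rw [ofReal_integral_eq_lintegral_ofReal hr
        (Filter.Eventually.of_forall fun x => gradSq_nonneg u x),
        ← lintegral_finsetSum _ fun b _ => ((dD_measurable u b).norm.pow_const 2).ennreal_ofReal]
      refine lintegral_congr fun x => ?_
      rw [← sum_dD_sq, ENNReal.ofReal_sum_of_nonneg fun _ _ => sq_nonneg _]
    have hball : t * R = (2 * t) * (R / 2) := by ring
    have h1 : ENNReal.ofReal (∫ x in ball x₀ (t * R), gradSq n N u x) ≤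
        C * ENNReal.ofReal (2 * t) ^ n * ENNReal.ofReal (∫ x in ball x₀ R, gradSq n N u x) := by
      rw [hlin _ (hInt.mono_set hsub), hlin _ hInt, Finset.mul_sum, hball]
      exact Finset.sum_le_sum fun b _ =>
        hdec x₀ R hR u hu hInt hweak b (2 * t) (by linarith) (by linarith)
    rw [← ENNReal.ofReal_toReal hC, ← ENNReal.ofReal_pow (by positivity),
      ← ENNReal.ofReal_mul (by positivity), ← ENNReal.ofReal_mul (by positivity),
      ENNReal.ofReal_le_ofReal_iff (by positivity)] at h1
    refine h1.trans ?_
    rw [mul_pow, ← mul_assoc]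
    gcongr
    have : (0 : ℝ) ≤ 4 ^ n := by positivity
    linarith
  · have h1 : ∫ x in ball x₀ (t * R), gradSq n N u x ≤ ∫ x in ball x₀ R, gradSq n N u x :=
      setIntegral_mono_set hInt (Filter.Eventually.of_forall fun x => gradSq_nonneg u x)
        hsub.eventuallyLE
    have h2 : (1 : ℝ) ≤ (C.toReal * 2 ^ n + 4 ^ n) * t ^ n := by
      have h3 : (1 : ℝ) ≤ (4 * t) ^ n := one_le_pow₀ (by linarith)
      rw [mul_pow] at h3
      have h5 : 0 ≤ C.toReal * 2 ^ n * t ^ n := by positivity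
      rw [add_mul]
      linarith
    exact h1.trans (le_mul_of_one_le_left hI h2)
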